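/- arXiv:2504.20709 — 2 statements merged into one kernel-verified Lean document; each statement's English description precedes it below -/
import Mathlib

section
/- Let d be a positive integer and let c : ℝ^d → ℂ be an integral ℝ^d-configuration (finite range, all values integers) whose support {u : c(u) ≠ 0} is a Delone set of finite local complexity, and assume c is annihilated by some non-trivial integral ℝ^d-polynomial f. Then for every u in the support of f there exist a finite (possibly empty) list of vectors v_1, …, v_m ∈ ℝ^d, pairwise linearly independent over ℝ, such that for each i there are u_i ∈ supp(f) \ {u} and a nonzero real r_i with v_i = r_i·(u_i − u), and c is annihilated by the product of difference ℝ^d-polynomials (X^{v_1}−1)⋯(X^{v_m}−1), i.e., Δ_{v_1}∘⋯∘Δ_{v_m}(c) = 0 (where the empty composition is the identity, so m = 0 asserts c = 0). -/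
/- STATEMENT 1: Special annihilator theorem for integral Delone configurations of
   finite local complexity: the difference-polynomial directions can be chosen
   pairwise linearly independent over ℝ. -/

open scoped Pointwise

noncomputable section

abbrev Euc (d : ℕ) := EuclideanSpace ℝ (Fin d)

def conv {d : ℕ} (f c : Euc d → ℂ) (u : Euc d) : ℂ := ∑ᶠ v, f v * c (u - v)

def Annihilates {d : ℕ} (f c : Euc d → ℂ) : Prop := ∀ u, conv f c u = 0

def Delta {d : ℕ} (v : Euc d) (c : Euc d → ℂ) : Euc d → ℂ := fun u => c (u - v) - c u

def UniformlyDiscrete {d : ℕ} (S : Set (Euc d)) : Prop :=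
  ∃ r > (0:ℝ), ∀ x : Euc d, (S ∩ Metric.ball x r).Subsingleton

def RelativelyDense {d : ℕ} (S : Set (Euc d)) : Prop :=
  ∃ R > (0:ℝ), ∀ x : Euc d, (S ∩ Metric.closedBall x R).Nonempty

def IsDelone {d : ℕ} (S : Set (Euc d)) : Prop := UniformlyDiscrete S ∧ RelativelyDense S

def SetLocallyFinite {d : ℕ} (S : Set (Euc d)) : Prop :=
  ∀ B : Set (Euc d), Bornology.IsBounded B → (S ∩ B).Finite

/-- A Delone set of finite local complexity. -/
def DeloneFLC {d : ℕ} (S : Set (Euc d)) : Prop := IsDelone S ∧ SetLocallyFinite (S - S)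

theorem slf_translate {d : ℕ} {A : Set (Euc d)} (hA : SetLocallyFinite A) (w : Euc d) :
    SetLocallyFinite ((fun x => x + w) '' A) := by
  intro B hB
  have h1 : Bornology.IsBounded ((fun x => x + (-w)) '' B) := by
    rw [Metric.isBounded_iff] at hB ⊢
    obtain ⟨C, hC⟩ := hB
    refine ⟨C, ?_⟩
    rintro _ ⟨x, hx, rfl⟩ _ ⟨y, hy, rfl⟩
    simpa using hC hx hy
  refine ((hA _ h1).image (fun x => x + w)).subset ?_
  rintro _ ⟨⟨x, hx, rfl⟩, hb⟩
  exact ⟨x, ⟨hx, ⟨x + w, hb, by simp⟩⟩, rfl⟩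

theorem slf_union {d : ℕ} {A A' : Set (Euc d)} (hA : SetLocallyFinite A)
    (hA' : SetLocallyFinite A') : SetLocallyFinite (A ∪ A') := by
  intro B hB
  rw [Set.union_inter_distrib_right]
  exact (hA B hB).union (hA' B hB)

theorem slf_delta {d : ℕ} {c : Euc d → ℂ}
    (h : SetLocallyFinite (Function.support c - Function.support c)) (v w : Euc d) :
    SetLocallyFinite (Function.support (Delta v c) - Function.support (Delta w c)) := by
  have key := slf_union (slf_union h (slf_translate h v))
    (slf_union (slf_translate h (-w)) (slf_translate h (v - w)))
  have hs : ∀ (v a : Euc d), a ∈ Function.support (Delta v c) →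
      a - v ∈ Function.support c ∨ a ∈ Function.support c := by
    intro v a ha
    by_contra hcon
    simp only [Function.mem_support, not_or, not_not] at hcon
    apply ha
    simp [Delta, hcon.1, hcon.2]
  intro B hB
  refine (key B hB).subset ?_
  rintro _ ⟨⟨a, ha, b, hb, rfl⟩, hab⟩
  refine ⟨?_, hab⟩
  rcases hs v a ha with ha | ha <;> rcases hs w b hb with hb | hb
  · exact Or.inr (Or.inr ⟨_, ⟨_, ha, _, hb, rfl⟩, by simp only; abel⟩)
  · exact Or.inl (Or.inr ⟨_, ⟨_, ha, _, hb, rfl⟩, by simp only; abel⟩)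
  · exact Or.inr (Or.inl ⟨_, ⟨_, ha, _, hb, rfl⟩, by simp only; abel⟩)
  · exact Or.inl (Or.inl ⟨_, ha, _, hb, rfl⟩)

theorem delta_comm {d : ℕ} (v w : Euc d) (c : Euc d → ℂ) :
    Delta v (Delta w c) = Delta w (Delta v c) := by
  funext u
  simp only [Delta]
  rw [sub_right_comm u v w]
  ring

theorem delta_zero_iff {d : ℕ} (v : Euc d) (c : Euc d → ℂ) :
    Delta v c = 0 ↔ Function.Periodic c v := by
  constructor
  · intro h x
    have := congrFun h (x + v)
    simp only [Delta, add_sub_cancel_right, Pi.zero_apply, sub_eq_zero] at this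
    exact this.symm
  · intro h
    funext u
    simp [Delta, h.sub_eq]

def GoodC {d : ℕ} (c : Euc d → ℂ) : Prop :=
  SetLocallyFinite (Function.support c - Function.support c) ∧ ∃ M : ℝ, ∀ u, ‖c u‖ ≤ M

theorem good_delta {d : ℕ} {c : Euc d → ℂ} (h : GoodC c) (v : Euc d) : GoodC (Delta v c) := by
  obtain ⟨h1, M, hM⟩ := h
  refine ⟨slf_delta h1 v v, M + M, fun u => ?_⟩
  exact (norm_sub_le _ _).trans (add_le_add (hM _) (hM _))

theorem good_foldr {d : ℕ} {c : Euc d → ℂ} (h : GoodC c) (L : List (Euc d)) :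
    GoodC (L.foldr Delta c) := by
  induction L with
  | nil => exact h
  | cons a L ih => exact good_delta ih a

theorem delta_sq {d : ℕ} {c : Euc d → ℂ} (h : GoodC c) (w : Euc d)
    (hw : Delta w (Delta w c) = 0) : Delta w c = 0 := by
  obtain ⟨-, M, hM⟩ := h
  rw [delta_zero_iff] at hw
  funext u
  have hk : ∀ k : ℕ, c (u - (k : ℕ) • w) = c u + k * Delta w c u := by
    intro k
    induction k with
    | zero => simp
    | succ k ih =>
      have h1 : Delta w c (u - k • w) = Delta w c u := hw.sub_nsmul_eq k
      have h2 : c (u - (k + 1) • w) = c (u - k • w) + Delta w c (u - k • w) := by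
        simp only [Delta]
        rw [succ_nsmul, ← sub_sub]; ring
      rw [h2, h1, ih]; push_cast; ring
  by_contra hne
  have hpos : 0 < ‖Delta w c u‖ := norm_pos_iff.mpr hne
  obtain ⟨k, hk'⟩ := exists_nat_gt ((M + M) / ‖Delta w c u‖)
  rw [div_lt_iff₀ hpos] at hk'
  have h3 : (k : ℂ) * Delta w c u = c (u - k • w) - c u := by rw [hk k]; ring
  have h4 : (k : ℝ) * ‖Delta w c u‖ ≤ M + M := by
    calc (k : ℝ) * ‖Delta w c u‖ = ‖(k : ℂ) * Delta w c u‖ := by simp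
      _ = ‖c (u - k • w) - c u‖ := by rw [h3]
      _ ≤ M + M := (norm_sub_le _ _).trans (add_le_add (hM _) (hM _))
  linarith

theorem merge {d : ℕ} {c : Euc d → ℂ} (h : GoodC c) (v : Euc d) (hv : v ≠ 0) (t : ℝ)
    (ht : t ≠ 0) (h0 : Delta v (Delta (t • v) c) = 0) :
    ∃ r : ℝ, r ≠ 0 ∧ Delta (r • v) c = 0 := by
  by_cases hirr : Irrational t
  · by_contra hcon
    push Not at hcon
    have n1 : Delta v c ≠ 0 := by simpa using hcon 1 one_ne_zero
    have n2 := hcon t ht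
    obtain ⟨x, hx⟩ := Function.ne_iff.mp n1
    obtain ⟨y, hy⟩ := Function.ne_iff.mp n2
    have p2 : Function.Periodic (Delta (t • v) c) v := (delta_zero_iff _ _).mp h0
    have p1 : Function.Periodic (Delta v c) (t • v) := by
      rw [delta_comm] at h0
      exact (delta_zero_iff _ _).mp h0
    have hlf := slf_delta h.1 v (t • v)
    let z : ℕ → Euc d := fun j => (x - y) + (Int.fract ((j : ℝ) * t)) • v
    have hzinj : Function.Injective z := by
      intro i j hij
      have h1 : Int.fract ((i : ℝ) * t) = Int.fract ((j : ℝ) * t) :=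
        smul_left_injective ℝ hv (add_left_cancel hij)
      rw [Int.fract_eq_fract] at h1
      obtain ⟨m, hm⟩ := h1
      by_contra hne
      have hne' : ((i : ℤ) - j : ℤ) ≠ 0 := by omega
      have := hirr.intCast_mul hne'
      apply this.ne_int m
      push_cast
      linarith
    have hzmem : Set.range z ⊆ (Function.support (Delta v c) -
        Function.support (Delta (t • v) c)) ∩ Metric.closedBall (x - y) ‖v‖ := by
      rintro _ ⟨j, rfl⟩
      constructor
      · refine ⟨x + j • (t • v), ?_, y + (⌊(j : ℝ) * t⌋) • v, ?_, ?_⟩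
        · simp only [Function.mem_support]
          rw [p1.nsmul j x]; exact hx
        · simp only [Function.mem_support]
          rw [p2.zsmul _ y]; exact hy
        · simp only [z, Int.fract, sub_smul, mul_smul]
          rw [← Nat.cast_smul_eq_nsmul ℝ, ← Int.cast_smul_eq_zsmul ℝ]
          abel
      · rw [Metric.mem_closedBall, dist_eq_norm]
        simp only [z, add_sub_cancel_left, norm_smul]
        have h1 := Int.fract_nonneg ((j : ℝ) * t)
        have h2 := (Int.fract_lt_one ((j : ℝ) * t)).le
        rw [Real.norm_of_nonneg h1]
        nlinarith [norm_nonneg v]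
    exact Set.infinite_range_of_injective hzinj
      ((hlf _ Metric.isBounded_closedBall).subset hzmem)
  · unfold Irrational at hirr
    push Not at hirr
    obtain ⟨q, rfl⟩ := hirr
    have hq : q ≠ 0 := by rintro rfl; simp at ht
    have hw : q.num • v = (q.den : ℤ) • ((q : ℝ) • v) := by
      rw [← Int.cast_smul_eq_zsmul ℝ, ← Int.cast_smul_eq_zsmul ℝ, smul_smul]
      congr 1
      have : (q : ℚ) * q.den = q.num := Rat.mul_den_eq_num q
      have : (q : ℝ) * q.den = q.num := by exact_mod_cast this
      push_cast
      linarith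
    refine ⟨q.num, by exact_mod_cast Rat.num_ne_zero.mpr hq, ?_⟩
    rw [Int.cast_smul_eq_zsmul ℝ]
    apply delta_sq h
    have s1 : Delta (q.num • v) (Delta ((q : ℝ) • v) c) = 0 :=
      (delta_zero_iff _ _).mpr (((delta_zero_iff _ _).mp h0).zsmul _)
    rw [delta_comm] at s1
    have s2 := (delta_zero_iff _ _).mpr (((delta_zero_iff _ _).mp s1).zsmul (q.den : ℤ))
    rw [← hw] at s2
    exact s2

instance deltaLC {d : ℕ} : LeftCommutative (Delta (d := d)) := ⟨delta_comm⟩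

theorem reduce_list {d : ℕ} {c : Euc d → ℂ} (h : GoodC c) (P : Euc d → Prop)
    (hP0 : ∀ v, P v → v ≠ 0) (hP : ∀ v (r : ℝ), r ≠ 0 → P v → P (r • v)) :
    ∀ (n : ℕ) (L : List (Euc d)), L.length = n → (∀ v ∈ L, P v) → L.foldr Delta c = 0 →
    ∃ L' : List (Euc d),
      L'.Pairwise (fun v w => ∀ a b : ℝ, a • v + b • w = 0 → a = 0 ∧ b = 0) ∧
      (∀ v ∈ L', P v) ∧ L'.foldr Delta c = 0 := by
  intro n
  induction n with
  | zero =>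
    intro L hL hLP h0
    obtain rfl := List.length_eq_zero_iff.mp hL
    exact ⟨[], List.Pairwise.nil, hLP, h0⟩
  | succ n ih =>
    intro L hL hLP h0
    by_cases hpw : L.Pairwise (fun v w => ∀ a b : ℝ, a • v + b • w = 0 → a = 0 ∧ b = 0)
    · exact ⟨L, hpw, hLP, h0⟩
    rw [List.pairwise_iff_forall_sublist] at hpw
    push Not at hpw
    obtain ⟨v, w, hsub, a, b, hab, hne⟩ := hpw
    obtain ⟨l, hl⟩ := hsub.exists_perm_append
    have hPv : P v := hLP v (hsub.subset (by simp))
    have hPw : P w := hLP w (hsub.subset (by simp))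
    have hv := hP0 v hPv
    have hw := hP0 w hPw
    have ha : a ≠ 0 := by
      rintro rfl
      have hb := hne rfl
      simp [hb, hw] at hab
    have hb : b ≠ 0 := by
      rintro rfl
      simp [ha, hv] at hab
    have hwv : w = (-(a / b)) • v := by
      have : b • w = -(a • v) := eq_neg_of_add_eq_zero_right hab
      rw [neg_smul, div_eq_inv_mul, mul_smul, ← smul_neg, ← this, smul_smul,
        inv_mul_cancel₀ hb, one_smul]
    rw [hl.foldr_eq] at h0
    simp only [List.cons_append, List.nil_append, List.foldr_cons] at h0
    rw [hwv] at h0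
    obtain ⟨r, hr, hr0⟩ := merge (good_foldr h l) v hv _
      (neg_ne_zero.mpr (div_ne_zero ha hb)) h0
    refine ih ((r • v) :: l) ?_ ?_ hr0
    · have := hl.length_eq
      simp at this ⊢
      omega
    · intro x hx
      rcases List.mem_cons.mp hx with rfl | hx
      · exact hP _ _ hr hPv
      · exact hLP x (hl.symm.subset (by simp [hx]))

-- algebraic part

def shiftHom (d : ℕ) : Multiplicative (Euc d) →* Module.End ℤ (Euc d → ℤ) where
  toFun v := { toFun := fun c u => c (u - v.toAdd), map_add' := fun _ _ => rfl,
               map_smul' := fun _ _ => rfl }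
  map_one' := by ext c u; simp
  map_mul' v w := by
    apply LinearMap.ext; intro c; funext u
    simp [sub_sub]

def act (d : ℕ) : AddMonoidAlgebra ℤ (Euc d) →ₐ[ℤ] Module.End ℤ (Euc d → ℤ) :=
  AddMonoidAlgebra.lift ℤ _ _ (shiftHom d)

theorem act_single {d : ℕ} (v : Euc d) (a : ℤ) (c : Euc d → ℤ) (u : Euc d) :
    act d (AddMonoidAlgebra.single v a) c u = a * c (u - v) := by
  simp [act, AddMonoidAlgebra.lift_single, shiftHom]

/-- the dilated polynomial. -/
def dil {d : ℕ} (s : Finset (Euc d)) (f : Euc d → ℤ) (n : ℕ) : AddMonoidAlgebra ℤ (Euc d) :=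
  ∑ v ∈ s, AddMonoidAlgebra.single (n • v) (f v)

theorem act_dil {d : ℕ} (s : Finset (Euc d)) (f : Euc d → ℤ) (n : ℕ) (c : Euc d → ℤ)
    (u : Euc d) : act d (dil s f n) c u = ∑ v ∈ s, f v * c (u - n • v) := by
  simp [dil, act_single]

theorem dil_frob {d : ℕ} (s : Finset (Euc d)) (f : Euc d → ℤ) (n p : ℕ) (hp : p.Prime) :
    ∃ h, dil s f (p * n) = dil s f n ^ p + (p : AddMonoidAlgebra ℤ (Euc d)) * h := by
  classical
  unfold dil
  induction s using Finset.induction_on with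
  | empty => exact ⟨0, by simp [hp.ne_zero]⟩
  | insert a s ha ih =>
    obtain ⟨h, hh⟩ := ih
    rw [Finset.sum_insert ha, Finset.sum_insert ha, hh]
    obtain ⟨r, hr⟩ := exists_add_pow_prime_eq hp (AddMonoidAlgebra.single (n • a) (f a))
      (∑ v ∈ s, AddMonoidAlgebra.single (n • v) (f v))
    rw [hr, AddMonoidAlgebra.single_pow]
    have hfl : ∃ k : ℤ, f a = f a ^ p + p * k := by
      have := Fact.mk hp
      have : (p : ℤ) ∣ f a - f a ^ p := by
        rw [← ZMod.intCast_zmod_eq_zero_iff_dvd]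
        simp [ZMod.pow_card]
      obtain ⟨k, hk⟩ := this
      exact ⟨k, by linarith⟩
    obtain ⟨k, hk⟩ := hfl
    have hs : AddMonoidAlgebra.single ((p * n) • a) (f a) =
        AddMonoidAlgebra.single (p • n • a) (f a ^ p) +
          (p : AddMonoidAlgebra ℤ (Euc d)) * AddMonoidAlgebra.single (p • n • a) k := by
      conv_lhs => rw [hk, mul_smul]
      rw [AddMonoidAlgebra.single_add]
      congr 1
      rw [← nsmul_eq_mul, ← nsmul_eq_mul, AddMonoidAlgebra.smul_single]
    rw [hs]
    refine ⟨AddMonoidAlgebra.single (p • n • a) k + h - AddMonoidAlgebra.single (n • a) (f a) *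
      (∑ v ∈ s, AddMonoidAlgebra.single (n • v) (f v)) * r, ?_⟩
    ring

theorem act_dil_zero {d : ℕ} (s : Finset (Euc d)) (f c : Euc d → ℤ) (M : ℤ)
    (hM : ∀ u, |c u| ≤ M) (h1 : act d (dil s f 1) c = 0) (N : ℕ)
    (hN : ∑ v ∈ s, |f v| * M < N) (n : ℕ) :
    n ≠ 0 → (∀ p : ℕ, p.Prime → p ∣ n → N ≤ p) → act d (dil s f n) c = 0 := by
  induction n using induction_on_primes with
  | zero => intro h; exact absurd rfl h
  | one => intro _ _; exact h1
  | prime_mul p n hp ih =>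
    intro hne hpr
    have hn : n ≠ 0 := by rintro rfl; simp at hne
    have ih' := ih hn (fun q hq hqn => hpr q hq (hqn.mul_left p))
    obtain ⟨h, hh⟩ := dil_frob s f n p hp
    funext u
    have hdvd : (p : ℤ) ∣ act d (dil s f (p * n)) c u := by
      rw [hh, map_add, map_mul, map_natCast]
      obtain ⟨m, rfl⟩ := Nat.exists_eq_succ_of_ne_zero hp.ne_zero
      rw [pow_succ, map_mul]
      simp only [LinearMap.add_apply, Module.End.mul_apply, ih', map_zero, Pi.add_apply,
        Pi.zero_apply, zero_add]
      rw [Module.End.natCast_apply]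
      exact ⟨act d h c u, by simp⟩
    have hb : |act d (dil s f (p * n)) c u| < p := by
      rw [act_dil]
      calc _ ≤ ∑ v ∈ s, |f v * c (u - (p * n) • v)| := Finset.abs_sum_le_sum_abs _ _
        _ ≤ ∑ v ∈ s, |f v| * M := by
          apply Finset.sum_le_sum
          intro v _
          rw [abs_mul]
          exact mul_le_mul_of_nonneg_left (hM _) (abs_nonneg _)
        _ < N := hN
        _ ≤ p := by exact_mod_cast hpr p hp (dvd_mul_right _ _)
    exact Int.eq_zero_of_abs_lt_dvd hdvd hb

theorem act_prod {d : ℕ} (s : Finset (Euc d)) (f c : Euc d → ℤ) (r : ℕ)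
    (h : ∀ i : ℕ, act d (dil s f (1 + i * r)) c = 0) (u : Euc d) (hu : u ∈ s) (hfu : f u ≠ 0) :
    act d (∏ w ∈ s.erase u, (AddMonoidAlgebra.single (r • (w - u)) 1 - 1)) c = 0 := by
  classical
  let X : Euc d → AddMonoidAlgebra ℤ (Euc d) := fun v => AddMonoidAlgebra.single v 1
  have hX : ∀ v w, X v * X w = X (v + w) := by
    intro v w; simp [X, AddMonoidAlgebra.single_mul_single]
  have hP : ∀ P : Polynomial (AddMonoidAlgebra ℤ (Euc d)),
      act d (∑ v ∈ s, P.eval (X (r • v)) * AddMonoidAlgebra.single v (f v)) c = 0 := by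
    intro P
    induction P using Polynomial.induction_on' with
    | add P Q hP hQ =>
      simp only [Polynomial.eval_add, add_mul, Finset.sum_add_distrib, map_add,
        LinearMap.add_apply] at hP hQ ⊢
      rw [hP, hQ, add_zero]
    | monomial i a =>
      have : ∑ v ∈ s, (Polynomial.monomial i a).eval (X (r • v)) * AddMonoidAlgebra.single v (f v)
          = a * dil s f (1 + i * r) := by
        rw [dil, Finset.mul_sum]
        apply Finset.sum_congr rfl
        intro v _
        rw [Polynomial.eval_monomial, mul_assoc]
        congr 1
        simp only [X, AddMonoidAlgebra.single_pow, AddMonoidAlgebra.single_mul_single, one_pow,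
          one_mul]
        congr 1
        rw [add_smul, one_smul, mul_smul, add_comm]
      rw [this, map_mul, Module.End.mul_apply, h i, map_zero]
  have h1 := hP (∏ w ∈ s.erase u, (Polynomial.X - Polynomial.C (X (r • w))))
  simp only [Polynomial.eval_prod, Polynomial.eval_sub, Polynomial.eval_X,
    Polynomial.eval_C] at h1
  rw [Finset.sum_eq_single u] at h1
  rotate_left
  · intro b hb hbu
    rw [Finset.prod_eq_zero (Finset.mem_erase.mpr ⟨hbu, hb⟩) (sub_self _), zero_mul]
  · intro h; exact absurd hu h
  have h2 : ∏ w ∈ s.erase u, (X (r • u) - X (r • w)) =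
      (∏ w ∈ s.erase u, (AddMonoidAlgebra.single (r • (w - u)) 1 - 1)) *
        ∏ w ∈ s.erase u, (- X (r • u)) := by
    rw [← Finset.prod_mul_distrib]
    apply Finset.prod_congr rfl
    intro w _
    have : X (r • w) = X (r • (w - u)) * X (r • u) := by
      rw [hX, ← smul_add, sub_add_cancel]
    rw [this]
    simp only [X]
    ring
  set g : AddMonoidAlgebra ℤ (Euc d) :=
    ∏ w ∈ s.erase u, (AddMonoidAlgebra.single (r • (w - u)) 1 - 1) with hg
  have h3 : (∏ w ∈ s.erase u, (- X (r • u))) * (∏ w ∈ s.erase u, (- X (- (r • u)))) = 1 := by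
    rw [← Finset.prod_mul_distrib]
    apply Finset.prod_eq_one
    intro w _
    rw [neg_mul_neg, hX]
    simp [X, AddMonoidAlgebra.one_def]
  have h4 : (∏ w ∈ s.erase u, (- X (- (r • u)))) * X (-u) *
      ((∏ w ∈ s.erase u, (X (r • u) - X (r • w))) * AddMonoidAlgebra.single u (f u))
      = ((f u : ℤ) : AddMonoidAlgebra ℤ (Euc d)) * g := by
    have h5 : X (-u) * AddMonoidAlgebra.single u (f u)
        = ((f u : ℤ) : AddMonoidAlgebra ℤ (Euc d)) := by
      simp [X, AddMonoidAlgebra.single_mul_single, AddMonoidAlgebra.intCast_def]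
    rw [h2, ← h5]
    linear_combination (X (-u) * AddMonoidAlgebra.single u (f u) * g) * h3
  have h6 : act d (((f u : ℤ) : AddMonoidAlgebra ℤ (Euc d)) * g) c = 0 := by
    rw [← h4, map_mul, Module.End.mul_apply, h1, map_zero]
  funext x
  have h7 := congrFun h6 x
  rw [map_mul, Module.End.mul_apply, map_intCast, Module.End.intCast_apply] at h7
  simpa [hfu] using h7

theorem foldr_act {d : ℕ} (L : List (Euc d)) (c : Euc d → ℤ) :
    L.foldr Delta (fun u => (c u : ℂ)) = fun u =>
      ((act d (L.map (fun v => AddMonoidAlgebra.single v (1 : ℤ) - 1)).prod c u : ℤ) : ℂ) := by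
  induction L with
  | nil => simp
  | cons a L ih =>
    rw [List.foldr_cons, ih]
    funext u
    rw [List.map_cons, List.prod_cons, map_mul, Module.End.mul_apply, map_sub, map_one,
      LinearMap.sub_apply, Pi.sub_apply, act_single]
    simp [Delta]

theorem stmt_1 (d : ℕ) (hd : 0 < d) (c : Euc d → ℂ)
    (hfin : (Set.range c).Finite) (hint : ∀ u, ∃ n : ℤ, c u = (n : ℂ))
    (hsupp : DeloneFLC (Function.support c))
    (f : Euc d → ℂ) (hfsupp : (Function.support f).Finite)
    (hfint : ∀ u, ∃ n : ℤ, f u = (n : ℂ)) (hf0 : f ≠ 0)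
    (hann : Annihilates f c) :
    ∀ u ∈ Function.support f, ∃ L : List (Euc d),
      L.Pairwise (fun v w => ∀ a b : ℝ, a • v + b • w = 0 → a = 0 ∧ b = 0) ∧
      (∀ v ∈ L, ∃ u' ∈ Function.support f, u' ≠ u ∧ ∃ r : ℝ, r ≠ 0 ∧ v = r • (u' - u)) ∧
      L.foldr Delta c = 0 := by
  classical
  intro u hu
  choose c0 hc0 using hint
  choose f0 hf0' using hfint
  obtain rfl : c = fun u => (c0 u : ℂ) := funext hc0
  obtain ⟨M, hM⟩ : ∃ M : ℤ, ∀ u, |c0 u| ≤ M := by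
    have h1 : (Set.range c0).Finite := by
      refine Set.Finite.of_finite_image (f := fun n : ℤ => (n : ℂ)) ?_
        (Int.cast_injective.injOn)
      rw [← Set.range_comp]
      exact hfin
    obtain ⟨M, hM⟩ := (h1.image (fun n => |n|)).bddAbove
    exact ⟨M, fun u => hM ⟨_, ⟨u, rfl⟩, rfl⟩⟩
  set s : Finset (Euc d) := hfsupp.toFinset with hs
  have hus : u ∈ s := by simpa [hs] using hu
  have hfu : f0 u ≠ 0 := by
    intro h
    apply hu
    rw [hf0' u, h]; simp
  have h1 : act d (dil s f0 1) c0 = 0 := by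
    funext x
    rw [act_dil]
    have := hann x
    unfold conv at this
    rw [finsum_eq_sum_of_support_subset (s := s)] at this
    · simp only [hf0'] at this
      simp only [one_smul, Pi.zero_apply]
      exact_mod_cast this
    · intro v hv
      simp only [hs, Set.Finite.coe_toFinset]
      exact fun h => hv (by simp [h])
  obtain ⟨N, hN⟩ : ∃ N : ℕ, ∑ v ∈ s, |f0 v| * M < N := by
    refine ⟨(∑ v ∈ s, |f0 v| * M).toNat + 1, ?_⟩
    have := Int.self_le_toNat (∑ v ∈ s, |f0 v| * M)
    push_cast
    omega
  have h2 : ∀ i : ℕ, act d (dil s f0 (1 + i * N.factorial)) c0 = 0 := by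
    intro i
    refine act_dil_zero s f0 c0 M hM h1 N hN _ (by omega) ?_
    intro p hp hpd
    by_contra hlt
    push Not at hlt
    have h3 : p ∣ i * N.factorial := (Nat.dvd_factorial hp.pos hlt.le).mul_left i
    exact hp.one_lt.ne' (Nat.dvd_one.mp ((Nat.dvd_add_left h3).mp hpd))
  have h3 := act_prod s f0 c0 _ h2 u hus hfu
  have hgood : GoodC (fun u => (c0 u : ℂ)) := by
    refine ⟨hsupp.2, M, fun u => ?_⟩
    rw [Complex.norm_intCast]
    exact_mod_cast hM u
  have hr : ((N.factorial : ℕ) : ℝ) ≠ 0 := by exact_mod_cast N.factorial_ne_zero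
  refine reduce_list hgood (fun v => ∃ u' ∈ Function.support f, u' ≠ u ∧
    ∃ r : ℝ, r ≠ 0 ∧ v = r • (u' - u)) ?_ ?_ _
    ((s.erase u).toList.map (fun w => N.factorial • (w - u))) rfl ?_ ?_
  · rintro v ⟨u', -, hne, r, hr, rfl⟩
    exact smul_ne_zero hr (sub_ne_zero.mpr hne)
  · rintro v r hr ⟨u', hu', hne, r', hr', rfl⟩
    exact ⟨u', hu', hne, r * r', mul_ne_zero hr hr', by rw [mul_smul]⟩
  · intro v hv
    rw [List.mem_map] at hv
    obtain ⟨w, hw, rfl⟩ := hv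
    rw [Finset.mem_toList, Finset.mem_erase] at hw
    refine ⟨w, by simpa [hs] using hw.2, hw.1, _, hr, ?_⟩
    rw [Nat.cast_smul_eq_nsmul ℝ]
  · rw [foldr_act, List.map_map]
    have h4 : (List.map ((fun v => AddMonoidAlgebra.single v (1 : ℤ) - 1) ∘
        fun w => N.factorial • (w - u)) (s.erase u).toList).prod
        = ∏ w ∈ s.erase u, (AddMonoidAlgebra.single (N.factorial • (w - u)) (1 : ℤ) - 1) := by
      rw [← Finset.prod_map_toList]; rfl
    rw [h4, h3]
    funext x; simp


end
end

section
/- Let d be a positive integer and let c : ℝ^d → ℂ be an ℝ^d-configuration (finite range) whose support is a Delone set of finite local complexity. Assume that for every nonzero w ∈ ℝ^d there exists an ℝ^d-polynomial f that annihilates c and has a vertex in direction w. Then c is strongly periodic, i.e., c has d period vectors linearly independent over ℝ. -/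
/- STATEMENT 4: Forced periodicity of Delone configurations of finite local
   complexity: annihilators with vertices in every direction force strong
   periodicity. -/

open scoped Pointwise
open RealInnerProductSpace

noncomputable section

/-- `f` has a vertex in direction `w`: some translate of the support of `f` lies in
the closed half space `{u | u·w ≤ 0}` and meets the hyperplane `{u | u·w = 0}`
exactly in the origin. -/
def HasVertexInDirection {d : ℕ} (f : Euc d → ℂ) (w : Euc d) : Prop :=
  ∃ t : Euc d,
    ((fun x => x + t) '' Function.support f) ⊆ {u : Euc d | ⟪u, w⟫ ≤ 0} ∧
    ((fun x => x + t) '' Function.support f) ∩ {u : Euc d | ⟪u, w⟫ = 0} = {0}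

def StronglyPeriodic {d : ℕ} (c : Euc d → ℂ) : Prop :=
  ∃ t : Fin d → Euc d, LinearIndependent ℝ t ∧ ∀ i, ∀ u, c (u - t i) = c u

def Det {d : ℕ} (c : Euc d → ℂ) (F : Finset (Euc d)) : Prop :=
  ∀ u t : Euc d, (∀ x ∈ F, c (u + x) = c (u + x - t)) → c u = c (u - t)

lemma exists_det {d : ℕ} (c f : Euc d → ℂ) (w : Euc d) (hf : (Function.support f).Finite)
    (ha : Annihilates f c) (hv : HasVertexInDirection f w) :
    ∃ F : Finset (Euc d), Det c F ∧ ∀ x ∈ F, 0 < ⟪x, w⟫ := by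
  classical
  obtain ⟨t0, h1, h2⟩ := hv
  have h0 : (0 : Euc d) ∈ ((fun x => x + t0) '' Function.support f) ∩
      {u : Euc d | ⟪u, w⟫ = 0} := by rw [h2]; rfl
  obtain ⟨⟨v0, hv0, hv0t⟩, -⟩ := h0
  have hvt : v0 + t0 = 0 := hv0t
  have ht0 : t0 = -v0 := by rw [eq_neg_iff_add_eq_zero, add_comm]; exact hvt
  subst ht0
  have hmem : v0 ∈ hf.toFinset := by simpa using hv0
  have key : ∀ u : Euc d, f v0 * c u +
      ∑ v ∈ hf.toFinset.erase v0, f v * c (u + (v0 - v)) = 0 := by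
    intro u
    have h := ha (u + v0)
    unfold conv at h
    rw [finsum_eq_sum_of_support_subset (s := hf.toFinset)] at h
    · rw [← Finset.add_sum_erase _ _ hmem] at h
      simpa [add_sub_assoc] using h
    · intro v hv
      simp only [Function.mem_support] at hv
      simp only [Set.Finite.coe_toFinset, Function.mem_support]
      exact left_ne_zero_of_mul hv
  refine ⟨(hf.toFinset.erase v0).image (fun v => v0 - v), ?_, ?_⟩
  · intro u t h
    have k1 := key u
    have k2 := key (u - t)
    have e : ∑ v ∈ hf.toFinset.erase v0, f v * c (u + (v0 - v))
        = ∑ v ∈ hf.toFinset.erase v0, f v * c (u - t + (v0 - v)) := by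
      apply Finset.sum_congr rfl
      intro v hv
      rw [h _ (Finset.mem_image_of_mem _ hv)]
      congr 2
      abel
    rw [e] at k1
    have : f v0 * c u = f v0 * c (u - t) := by linear_combination k1 - k2
    exact mul_left_cancel₀ hv0 this
  · intro x hx
    obtain ⟨v, hv, rfl⟩ := Finset.mem_image.1 hx
    rw [Finset.mem_erase] at hv
    have hvs : v ∈ Function.support f := by simpa using hv.2
    have hle : ⟪v + -v0, w⟫ ≤ 0 := h1 ⟨v, hvs, rfl⟩
    have hne : ⟪v + -v0, w⟫ ≠ 0 := by
      intro h
      have : v + -v0 ∈ ({0} : Set (Euc d)) := by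
        rw [← h2]; exact ⟨⟨v, hvs, rfl⟩, h⟩
      apply hv.1
      have h' : v + -v0 = 0 := this
      rwa [← sub_eq_add_neg, sub_eq_zero] at h'
    have : ⟪v0 - v, w⟫ = - ⟪v + -v0, w⟫ := by
      rw [← inner_neg_left]; congr 1; abel
    rw [this]
    have := lt_of_le_of_ne hle hne
    linarith

lemma uniform_det {d : ℕ} (c : Euc d → ℂ)
    (h : ∀ w : Euc d, w ≠ 0 → ∃ F : Finset (Euc d), Det c F ∧ ∀ x ∈ F, 0 < ⟪x, w⟫) :
    ∃ ε > (0:ℝ), ∃ R : ℝ, ∀ w ∈ Metric.sphere (0 : Euc d) 1, ∃ F : Finset (Euc d), Det c F ∧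
      ∀ x ∈ F, ε ≤ ⟪x, w⟫ ∧ ‖x‖ ≤ R := by
  refine IsCompact.induction_on (isCompact_sphere (0 : Euc d) 1)
    (p := fun s => ∃ ε > (0:ℝ), ∃ R : ℝ, ∀ w ∈ s, ∃ F : Finset (Euc d), Det c F ∧
      ∀ x ∈ F, ε ≤ ⟪x, w⟫ ∧ ‖x‖ ≤ R) ?_ ?_ ?_ ?_
  · exact ⟨1, one_pos, 0, by simp⟩
  · rintro s t hst ⟨ε, he, R, H⟩
    exact ⟨ε, he, R, fun w hw => H w (hst hw)⟩
  · rintro s t ⟨ε, he, R, H⟩ ⟨ε', he', R', H'⟩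
    refine ⟨min ε ε', lt_min he he', max R R', ?_⟩
    rintro w (hw | hw)
    · obtain ⟨F, hF, hx⟩ := H w hw
      exact ⟨F, hF, fun x hxF => ⟨(min_le_left _ _).trans (hx x hxF).1,
        (hx x hxF).2.trans (le_max_left _ _)⟩⟩
    · obtain ⟨F, hF, hx⟩ := H' w hw
      exact ⟨F, hF, fun x hxF => ⟨(min_le_right _ _).trans (hx x hxF).1,
        (hx x hxF).2.trans (le_max_right _ _)⟩⟩
  · intro w hw
    have hw0 : w ≠ 0 := by
      rintro rfl
      simp at hw
    obtain ⟨F, hF, hx⟩ := h w hw0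
    have hε : ∃ ε > (0:ℝ), ∀ x ∈ F, ε < ⟪x, w⟫ := by
      have : ∀ᶠ ε in nhdsWithin (0:ℝ) (Set.Ioi 0), ∀ x ∈ F, ε < ⟪x, w⟫ := by
        rw [Filter.eventually_all_finset]
        intro x hxF
        exact nhdsWithin_le_nhds (gt_mem_nhds (hx x hxF))
      obtain ⟨ε, h1, h2⟩ := (this.and self_mem_nhdsWithin).exists
      exact ⟨ε, h2, h1⟩
    obtain ⟨ε, he, hεx⟩ := hε
    refine ⟨{w' | ∀ x ∈ F, ε < ⟪x, w'⟫}, ?_, ε, he, ∑ x ∈ F, ‖x‖, ?_⟩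
    · apply nhdsWithin_le_nhds
      change ∀ᶠ w' in nhds w, ∀ x ∈ F, ε < ⟪x, w'⟫
      rw [Filter.eventually_all_finset]
      intro x hxF
      have hc : Continuous (fun w' : Euc d => ⟪x, w'⟫) := by fun_prop
      exact hc.continuousAt.eventually (lt_mem_nhds (hεx x hxF))
    · intro w' hw'
      exact ⟨F, hF, fun x hxF => ⟨(hw' x hxF).le,
        Finset.single_le_sum (f := fun x : Euc d => ‖x‖) (fun _ _ => norm_nonneg _) hxF⟩⟩

lemma ball_det {d : ℕ} (c : Euc d → ℂ)
    (h : ∃ ε > (0:ℝ), ∃ R : ℝ, ∀ w ∈ Metric.sphere (0 : Euc d) 1, ∃ F : Finset (Euc d), Det c F ∧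
      ∀ x ∈ F, ε ≤ ⟪x, w⟫ ∧ ‖x‖ ≤ R) :
    ∃ ρ > (0:ℝ), ∀ p t : Euc d, (∀ u, ‖u - p‖ < ρ → c u = c (u - t)) →
      ∀ u, c u = c (u - t) := by
  obtain ⟨ε, he, R, H⟩ := h
  have hR : 0 ≤ R ^ 2 / ε := by positivity
  refine ⟨R ^ 2 / ε + ε + 1, by positivity, ?_⟩
  intro p t h0
  have main : ∀ n : ℕ, ∀ u, ‖u - p‖ < R ^ 2 / ε + ε + 1 + n * (ε / 2) → c u = c (u - t) := by
    intro n
    induction n with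
    | zero => simpa using h0
    | succ n ih =>
      intro u hu
      by_cases hlt : ‖u - p‖ < R ^ 2 / ε + ε + 1
      · exact h0 u hlt
      push Not at hlt
      set ρ := ‖u - p‖ with hρ
      have hpos : 0 < ρ := by linarith
      obtain ⟨F, hF, hx⟩ := H (-(ρ⁻¹ • (u - p))) (by
        rw [mem_sphere_zero_iff_norm, norm_neg, norm_smul, norm_inv, Real.norm_of_nonneg hpos.le,
          ← hρ, inv_mul_cancel₀ hpos.ne'])
      apply hF
      intro x hxF
      apply ih
      obtain ⟨h1, h2⟩ := hx x hxF
      rw [inner_neg_right, inner_smul_right] at h1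
      have h3 : ⟪x, u - p⟫ ≤ - (ε * ρ) := by
        have := mul_le_mul_of_nonneg_right h1 hpos.le
        have e : -(ρ⁻¹ * ⟪x, u - p⟫) * ρ = - ⟪x, u - p⟫ := by field_simp
        rw [e] at this
        linarith
      have h4 : ‖u + x - p‖ ^ 2 = ρ ^ 2 + 2 * ⟪x, u - p⟫ + ‖x‖ ^ 2 := by
        have : u + x - p = (u - p) + x := by abel
        rw [this, norm_add_sq_real, real_inner_comm]
      have h5 : ‖x‖ ^ 2 ≤ R ^ 2 := by
        gcongr
      have h6 : R ^ 2 ≤ ε * ρ := by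
        have : R ^ 2 / ε ≤ ρ := by linarith
        rw [div_le_iff₀ he] at this
        linarith
      have h7 : ‖u + x - p‖ ≤ ρ - ε / 2 := by
        refine (abs_le_of_sq_le_sq' ?_ (by linarith)).2
        rw [h4]
        nlinarith
      push_cast at hu
      linarith
  intro u
  obtain ⟨n, hn⟩ := exists_nat_gt (‖u - p‖ / (ε / 2))
  rw [div_lt_iff₀ (by positivity)] at hn
  exact main n u (by linarith)

lemma finite_patterns {d : ℕ} (c : Euc d → ℂ) (hfin : (Set.range c).Finite)
    (hflc : SetLocallyFinite (Function.support c - Function.support c)) (ρ : ℝ) :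
    ∃ (α : Type) (_ : Finite α) (φ : Euc d → α), ∀ p ∈ Function.support c,
      ∀ q ∈ Function.support c, φ p = φ q → ∀ x, ‖x‖ < ρ → c (p + x) = c (q + x) := by
  have hK := hflc (Metric.ball 0 ρ) Metric.isBounded_ball
  set K := (Function.support c - Function.support c) ∩ Metric.ball 0 ρ with hKdef
  have := hK.to_subtype
  have := hfin.to_subtype
  refine ⟨K → Set.range c, inferInstance, fun p x => ⟨c (p + x), Set.mem_range_self _⟩, ?_⟩
  intro p hp q hq hpq x hx
  by_cases hxK : x ∈ K
  · have := congrFun hpq ⟨x, hxK⟩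
    simpa using this
  · have aux : ∀ p ∈ Function.support c, c (p + x) = 0 := by
      intro p hp
      by_contra hne
      apply hxK
      refine ⟨⟨p + x, hne, p, hp, by simp⟩, by simpa using hx⟩
    rw [aux p hp, aux q hq]

lemma not_dense {d : ℕ} (S : Set (Euc d)) (hS : RelativelyDense S) (V : Submodule ℝ (Euc d))
    (T : Set (Euc d)) (hT : T.Finite) (h : ∀ p ∈ S, ∃ q ∈ T, p - q ∈ V) : V = ⊤ := by
  by_contra hV
  have : Vᗮ ≠ ⊥ := by
    intro hb
    exact hV ((Submodule.orthogonal_eq_bot_iff).1 hb)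
  obtain ⟨n, hn, hn0⟩ := Submodule.exists_mem_ne_zero_of_ne_bot this
  obtain ⟨R, hR, hd⟩ := hS
  obtain ⟨M, hM⟩ := (hT.image (fun q => ⟪q, n⟫)).bddAbove
  have hnn : 0 < ‖n‖ := norm_pos_iff.2 hn0
  set s := (M + R * ‖n‖ + 1) / ‖n‖ ^ 2 with hs
  obtain ⟨p, hpS, hpB⟩ := hd (s • n)
  obtain ⟨q, hq, hpq⟩ := h p hpS
  have h1 : ⟪p - q, n⟫ = 0 := Submodule.inner_right_of_mem_orthogonal hpq hn
  have h2 : ⟪q, n⟫ ≤ M := hM ⟨q, hq, rfl⟩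
  rw [inner_sub_left] at h1
  have h3 : ‖s • n - p‖ ≤ R := by
    rw [← dist_eq_norm, dist_comm]; exact hpB
  have h4 : ⟪s • n - p, n⟫ ≤ R * ‖n‖ :=
    (real_inner_le_norm _ _).trans (by gcongr)
  rw [inner_sub_left, real_inner_smul_left, real_inner_self_eq_norm_sq, hs,
    div_mul_cancel₀ _ (by positivity)] at h4
  linarith

theorem stmt_4 (d : ℕ) (hd : 0 < d) (c : Euc d → ℂ)
    (hfin : (Set.range c).Finite)
    (hsupp : DeloneFLC (Function.support c))
    (hvert : ∀ w : Euc d, w ≠ 0 → ∃ f : Euc d → ℂ,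
      (Function.support f).Finite ∧ Annihilates f c ∧ HasVertexInDirection f w) :
    StronglyPeriodic c := by
  obtain ⟨⟨-, hdense⟩, hflc⟩ := hsupp
  obtain ⟨ρ, hρ, hdet⟩ := ball_det c (uniform_det c (fun w hw => by
    obtain ⟨f, h1, h2, h3⟩ := hvert w hw
    exact exists_det c f w h1 h2 h3))
  obtain ⟨α, hα, φ, hφ⟩ := finite_patterns c hfin hflc ρ
  let P : Set (Euc d) := {t | ∀ u, c (u - t) = c u}
  have hP : ∀ p ∈ Function.support c, ∀ q ∈ Function.support c, φ p = φ q → p - q ∈ P := by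
    intro p hp q hq hpq u
    refine (hdet p (p - q) ?_ u).symm
    intro u hu
    have := hφ p hp q hq hpq (u - p) hu
    rw [add_sub_cancel] at this
    rw [this]
    congr 1
    abel
  have hex : ∀ a : α, ∃ q : Euc d, (∃ p ∈ Function.support c, φ p = a) →
      q ∈ Function.support c ∧ φ q = a := by
    intro a
    by_cases h : ∃ p ∈ Function.support c, φ p = a
    · obtain ⟨p, hp⟩ := h
      exact ⟨p, fun _ => hp⟩
    · exact ⟨0, fun h' => absurd h' h⟩
  choose g hg using hex
  have htop : Submodule.span ℝ P = ⊤ := by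
    apply not_dense _ hdense _ (Set.range g) (Set.finite_range g)
    intro p hp
    obtain ⟨h1, h2⟩ := hg (φ p) ⟨p, hp, rfl⟩
    exact ⟨_, ⟨φ p, rfl⟩, Submodule.subset_span (hP p hp _ h1 h2.symm)⟩
  obtain ⟨b, hbP, hbs, hbi⟩ := exists_linearIndependent ℝ P
  rw [htop] at hbs
  let B : Module.Basis b ℝ (Euc d) := Module.Basis.mk hbi (by simp [hbs])
  let e : Fin d ≃ b := (EuclideanSpace.basisFun (Fin d) ℝ).toBasis.indexEquiv B
  exact ⟨fun i => (e i : Euc d), hbi.comp e e.injective, fun i u => hbP (e i).2 u⟩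

end
end
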